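/- Every 4×4 unitary complex matrix u, indexed by pairs (i,j) ∈ {1,2}×{1,2}, with dim_ℂ Ker(u − I) = 3 is product unitary equivalent to u(a,λ) for exactly one pair (a,λ) with 0 ≤ a ≤ 1/√2, |λ| = 1 and λ ≠ 1; that is, such a pair exists, and if u(a,λ) and u(b,μ) (with 0 ≤ a,b ≤ 1/√2, |λ| = |μ| = 1, λ,μ ≠ 1) are product unitary equivalent then a = b and λ = μ. -/

import Mathlib

open Matrix

/-- The 4×4 matrix `u(a,λ)`, indexed by `{1,2}×{1,2}` in lexicographic order. -/
noncomputable def uMat (a : ℝ) (l : ℂ) :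
    Matrix (Fin 2 × Fin 2) (Fin 2 × Fin 2) ℂ :=
  Matrix.of fun p q =>
    if p = (0, 0) ∧ q = (0, 0) then (l - 1) * (a : ℂ) ^ 2 + 1
    else if p = (0, 0) ∧ q = (1, 1) then (l - 1) * (a : ℂ) * (Real.sqrt (1 - a ^ 2) : ℂ)
    else if p = (1, 1) ∧ q = (0, 0) then (l - 1) * (a : ℂ) * (Real.sqrt (1 - a ^ 2) : ℂ)
    else if p = (1, 1) ∧ q = (1, 1) then l + (1 - l) * (a : ℂ) ^ 2
    else if p = q then 1 else 0

/-- Product unitary equivalence of 4×4 matrices indexed by pairs. -/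
def ProdUnitaryEquiv (u v : Matrix (Fin 2 × Fin 2) (Fin 2 × Fin 2) ℂ) : Prop :=
  ∃ A B : Matrix (Fin 2) (Fin 2) ℂ,
    A ∈ Matrix.unitaryGroup (Fin 2) ℂ ∧ B ∈ Matrix.unitaryGroup (Fin 2) ℂ ∧
    (Matrix.kroneckerMap (· * ·) A B) * u = v * (Matrix.kroneckerMap (· * ·) A B)

section

open scoped Kronecker ComplexOrder

/-- The vector of `ℂ² ⊗ ℂ²` whose coordinates are the entries of a `2 × 2` matrix. -/
def vecOfMatrix (X : Matrix (Fin 2) (Fin 2) ℂ) : Fin 2 × Fin 2 → ℂ := fun p => X p.1 p.2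

/-- The matrix of Schmidt coefficients `a` and `√(1 - a²)`. -/
noncomputable def schmidtMatrix (a : ℝ) : Matrix (Fin 2) (Fin 2) ℂ :=
  diagonal ![(a : ℂ), (Real.sqrt (1 - a ^ 2) : ℂ)]

lemma sq_le_half_of_le {a : ℝ} (h0 : 0 ≤ a) (h : a ≤ 1 / Real.sqrt 2) : a ^ 2 ≤ 1 / 2 := by
  have h2 : a ^ 2 ≤ (1 / Real.sqrt 2) ^ 2 := by gcongr
  rwa [div_pow, Real.sq_sqrt (by norm_num), one_pow] at h2

lemma uMat_eq {a : ℝ} (ha : a ^ 2 ≤ 1 / 2) (l : ℂ) :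
    uMat a l = 1 + (l - 1) • vecMulVec (vecOfMatrix (schmidtMatrix a))
      (star (vecOfMatrix (schmidtMatrix a))) := by
  have hs : ((Real.sqrt (1 - a ^ 2) : ℝ) : ℂ) * (Real.sqrt (1 - a ^ 2) : ℝ) = 1 - (a : ℂ) ^ 2 := by
    rw [← Complex.ofReal_mul, Real.mul_self_sqrt (by linarith)]
    push_cast; ring
  ext ⟨i, j⟩ ⟨k, m⟩
  fin_cases i <;> fin_cases j <;> fin_cases k <;> fin_cases m <;>
    simp [uMat, vecMulVec_apply, vecOfMatrix, schmidtMatrix]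
  · ring
  · ring
  · ring
  · rw [hs]; ring

lemma kronecker_mulVec_vecOfMatrix (A B X : Matrix (Fin 2) (Fin 2) ℂ) :
    (A ⊗ₖ B) *ᵥ vecOfMatrix X = vecOfMatrix (A * X * Bᵀ) := by
  ext ⟨i, j⟩
  simp [mulVec, dotProduct, vecOfMatrix, mul_apply, Fintype.sum_prod_type]
  ring

lemma star_dotProduct_vecOfMatrix (X : Matrix (Fin 2) (Fin 2) ℂ) :
    star (vecOfMatrix X) ⬝ᵥ vecOfMatrix X = (X * Xᴴ).trace := by
  simp [dotProduct, vecOfMatrix, mul_apply, trace, Fintype.sum_prod_type]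
  ring

lemma exists_eq_vecMulVec_of_finrank_range_eq_one {n : Type*} [Fintype n] [DecidableEq n]
    {M : Matrix n n ℂ} (h : Module.finrank ℂ (LinearMap.range M.mulVecLin) = 1) :
    ∃ v ≠ 0, ∃ y, M = vecMulVec v y := by
  obtain ⟨⟨v, hvM⟩, hv, hspan⟩ := finrank_eq_one_iff'.1 h
  have hcol (j : n) : ∃ c : ℂ, c • v = M *ᵥ Pi.single j 1 := by
    obtain ⟨c, hc⟩ := hspan ⟨M *ᵥ Pi.single j 1, Pi.single j 1, rfl⟩
    exact ⟨c, congrArg Subtype.val hc⟩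
  choose y hy using hcol
  refine ⟨v, fun h0 => hv (Subtype.ext h0), y, ?_⟩
  ext i j
  have := congrFun (hy j) i
  simp only [mulVec_single_one, Pi.smul_apply, smul_eq_mul] at this
  rw [vecMulVec_apply, mul_comm, this]
  rfl

lemma eq_smul_star_of_vecMulVec_normal {n : Type*} [Fintype n] {v y : n → ℂ} (hv : v ≠ 0)
    (h : vecMulVec v y * (vecMulVec v y)ᴴ = (vecMulVec v y)ᴴ * vecMulVec v y) :
    ∃ k : ℂ, y = k • star v := by
  by_cases hy : y = 0
  · exact ⟨0, by simp [hy]⟩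
  obtain ⟨i, hi⟩ := Function.ne_iff.1 hy
  have hs : star v ⬝ᵥ v ≠ 0 := fun h0 => hv (dotProduct_star_self_eq_zero.1 h0)
  have hi' : star (y i) ≠ 0 := star_ne_zero.2 hi
  rw [conjTranspose_vecMulVec, vecMulVec_mul_vecMulVec, vecMulVec_mul_vecMulVec] at h
  refine ⟨(y ⬝ᵥ star y) * v i / ((star v ⬝ᵥ v) * star (y i)), ?_⟩
  ext j
  have := congrFun (congrFun h i) j
  simp only [vecMulVec_apply, Pi.smul_apply, Pi.star_apply, smul_eq_mul] at this ⊢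
  field_simp
  linear_combination -this

lemma norm_one_add_of_mem_unitary {n : Type*} [Fintype n] [DecidableEq n] {x : n → ℂ} {c : ℂ}
    (hx : star x ⬝ᵥ x = 1) (hu : 1 + c • vecMulVec x (star x) ∈ unitaryGroup n ℂ) :
    ‖1 + c‖ = 1 := by
  have hmul : (1 + c • vecMulVec x (star x)) *ᵥ x = (1 + c) • x := by
    rw [add_mulVec, one_mulVec, smul_mulVec, vecMulVec_mulVec, hx, add_smul, one_smul]
    simp
  have h1 := mem_unitaryGroup_iff'.1 hu
  have h2 : star ((1 + c • vecMulVec x (star x)) *ᵥ x) ⬝ᵥ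
      ((1 + c • vecMulVec x (star x)) *ᵥ x) = 1 := by
    rw [star_mulVec, ← dotProduct_mulVec, mulVec_mulVec, ← star_eq_conjTranspose, h1,
      one_mulVec, hx]
  rw [hmul, star_smul, smul_dotProduct, dotProduct_smul, hx, smul_eq_mul, smul_eq_mul, mul_one,
    Complex.star_def, Complex.conj_mul'] at h2
  have h3 : ‖1 + c‖ ^ 2 = 1 := by exact_mod_cast h2
  nlinarith [norm_nonneg (1 + c)]

lemma exists_eq_one_add_smul_of_finrank_ker {u : Matrix (Fin 2 × Fin 2) (Fin 2 × Fin 2) ℂ}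
    (hu : u ∈ unitaryGroup (Fin 2 × Fin 2) ℂ)
    (hk : Module.finrank ℂ (LinearMap.ker (mulVecLin (u - 1))) = 3) :
    ∃ (l : ℂ) (X : Matrix (Fin 2) (Fin 2) ℂ), ‖l‖ = 1 ∧ l ≠ 1 ∧ (X * Xᴴ).trace = 1 ∧
      u = 1 + (l - 1) • vecMulVec (vecOfMatrix X) (star (vecOfMatrix X)) := by
  have hr := (mulVecLin (u - 1)).finrank_range_add_finrank_ker
  rw [hk] at hr
  have hr1 : Module.finrank ℂ (LinearMap.range (u - 1).mulVecLin) = 1 := by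
    simp at hr
    omega
  obtain ⟨v, hv, y, hM⟩ := exists_eq_vecMulVec_of_finrank_range_eq_one hr1
  have hne : u - 1 ≠ 0 := by
    intro h
    rw [h, mulVecLin_zero, LinearMap.range_zero, finrank_bot] at hr1
    omega
  have hnormal : (u - 1) * (u - 1)ᴴ = (u - 1)ᴴ * (u - 1) := by
    have h1 := mem_unitaryGroup_iff.1 hu
    have h2 := mem_unitaryGroup_iff'.1 hu
    rw [star_eq_conjTranspose] at h1 h2
    rw [conjTranspose_sub, conjTranspose_one, sub_mul, mul_sub, mul_sub, sub_mul, mul_sub, mul_sub,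
      h1, h2]
    simp only [mul_one, one_mul]
    abel
  rw [hM] at hnormal
  obtain ⟨k, rfl⟩ := eq_smul_star_of_vecMulVec_normal hv hnormal
  have hspos : 0 < star v ⬝ᵥ v := dotProduct_star_self_pos_iff.2 hv
  obtain ⟨s, hs, hsv⟩ : ∃ s : ℝ, 0 < s ∧ star v ⬝ᵥ v = ((s ^ 2 : ℝ) : ℂ) := by
    obtain ⟨hre, him⟩ := Complex.pos_iff.1 hspos
    refine ⟨Real.sqrt (star v ⬝ᵥ v).re, Real.sqrt_pos.2 hre, ?_⟩
    rw [Real.sq_sqrt hre.le]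
    exact Complex.ext rfl (by simp [← him])
  have hsc : (s : ℂ) ≠ 0 := by exact_mod_cast hs.ne'
  let X : Matrix (Fin 2) (Fin 2) ℂ := of fun i j => (s : ℂ)⁻¹ * v (i, j)
  have hX : vecOfMatrix X = (s : ℂ)⁻¹ • v := rfl
  have hX1 : star (vecOfMatrix X) ⬝ᵥ vecOfMatrix X = 1 := by
    rw [hX, star_smul, smul_dotProduct, dotProduct_smul, hsv]
    simp
    field_simp
  have hueq : u = 1 + (k * s ^ 2) • vecMulVec (vecOfMatrix X) (star (vecOfMatrix X)) := by
    rw [← sub_eq_iff_eq_add', hM, hX]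
    ext i j
    simp [vecMulVec_apply]
    field_simp
  refine ⟨1 + k * s ^ 2, X, norm_one_add_of_mem_unitary hX1 (hueq ▸ hu), ?_, ?_, ?_⟩
  · intro h
    apply hne
    rw [hueq, add_eq_left.1 h]
    simp
  · rw [← star_dotProduct_vecOfMatrix, hX1]
  · rw [add_sub_cancel_left]
    exact hueq

lemma exists_unitary_diagonalization {H : Matrix (Fin 2) (Fin 2) ℂ} (hH : H.IsHermitian) :
    ∃ U ∈ unitaryGroup (Fin 2) ℂ, ∃ d e : ℝ, d ≤ e ∧
      U * H * Uᴴ = diagonal ![(d : ℂ), (e : ℂ)] := by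
  have h := hH.conjStarAlgAut_star_eigenvectorUnitary
  rw [Unitary.conjStarAlgAut_star_apply] at h
  set V : Matrix (Fin 2) (Fin 2) ℂ := ↑hH.eigenvectorUnitary
  have hV : star V ∈ unitaryGroup (Fin 2) ℂ := Unitary.star_mem hH.eigenvectorUnitary.2
  rcases le_total (hH.eigenvalues 0) (hH.eigenvalues 1) with hle | hle
  · refine ⟨star V, hV, _, _, hle, ?_⟩
    rw [← star_eq_conjTranspose, star_star, h]
    congr 1
    ext i
    fin_cases i <;> rfl
  · let P : Matrix (Fin 2) (Fin 2) ℂ := !![0, 1; 1, 0]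
    have hP : P ∈ unitaryGroup (Fin 2) ℂ := by
      rw [mem_unitaryGroup_iff]
      ext i j
      fin_cases i <;> fin_cases j <;> simp [P, mul_apply, star_apply]
    refine ⟨P * star V, mul_mem hP hV, _, _, hle, ?_⟩
    have : P * star V * H * (P * star V)ᴴ = P * (star V * H * V) * Pᴴ := by
      rw [conjTranspose_mul, ← star_eq_conjTranspose (star V), star_star]
      simp only [Matrix.mul_assoc]
    rw [this, h]
    ext i j
    fin_cases i <;> fin_cases j <;> simp [P, mul_apply, vecMul_diagonal]

/-- If the rows of `Y` are orthogonal and the last one is nonzero, then normalizing them (and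
completing) gives a unitary matrix. -/
lemma exists_unitary_of_rows_orthogonal {Y : Matrix (Fin 2) (Fin 2) ℂ} {d e : ℝ} (he : 0 < e)
    (hY : Y * Yᴴ = diagonal ![(d : ℂ), (e : ℂ)]) :
    ∃ V ∈ unitaryGroup (Fin 2) ℂ,
      Y = diagonal ![(Real.sqrt d : ℂ), (Real.sqrt e : ℂ)] * V := by
  have h00 := congrFun (congrFun hY 0) 0
  have h11 := congrFun (congrFun hY 1) 1
  simp only [mul_apply, Fin.sum_univ_two, conjTranspose_apply, Complex.star_def,
    Complex.mul_conj', diagonal_apply_eq, cons_val_zero] at h00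
  norm_cast at h00
  have hse : (Real.sqrt e : ℂ) ≠ 0 := by exact_mod_cast (Real.sqrt_pos.2 he).ne'
  have hse2 : (Real.sqrt e : ℂ) * (Real.sqrt e : ℂ) = e := by
    exact_mod_cast Real.mul_self_sqrt he.le
  rcases (show 0 ≤ d by rw [← h00]; positivity).eq_or_lt with rfl | hd
  · have hz0 : Y 0 0 = 0 := norm_eq_zero.1 (by nlinarith [sq_nonneg ‖Y 0 0‖, sq_nonneg ‖Y 0 1‖])
    have hz1 : Y 0 1 = 0 := norm_eq_zero.1 (by nlinarith [sq_nonneg ‖Y 0 0‖, sq_nonneg ‖Y 0 1‖])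
    simp only [mul_apply, Fin.sum_univ_two, conjTranspose_apply, Complex.star_def,
      diagonal_apply_eq, cons_val_one, cons_val_fin_one] at h11
    refine ⟨(Real.sqrt e : ℂ)⁻¹ • !![-star (Y 1 1), star (Y 1 0); Y 1 0, Y 1 1], ?_, ?_⟩
    · rw [mem_unitaryGroup_iff]
      ext i j
      fin_cases i <;> fin_cases j <;> simp [mul_apply, star_apply] <;> field_simp
      · linear_combination h11 - hse2
      · ring
      · ring
      · linear_combination h11 - hse2
    · ext i j
      fin_cases i <;> fin_cases j <;> simp [hz0, hz1, hse]
  · have hsd : (Real.sqrt d : ℂ) ≠ 0 := by exact_mod_cast (Real.sqrt_pos.2 hd).ne'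
    have hsd2 : (Real.sqrt d : ℂ) * (Real.sqrt d : ℂ) = d := by
      exact_mod_cast Real.mul_self_sqrt hd.le
    let D : Matrix (Fin 2) (Fin 2) ℂ := diagonal ![(Real.sqrt d : ℂ)⁻¹, (Real.sqrt e : ℂ)⁻¹]
    refine ⟨D * Y, ?_, ?_⟩
    · have : D * Y * (D * Y)ᴴ = D * (Y * Yᴴ) * Dᴴ := by
        rw [conjTranspose_mul]
        simp only [Matrix.mul_assoc]
      rw [mem_unitaryGroup_iff, star_eq_conjTranspose, this, hY]
      ext i j
      fin_cases i <;> fin_cases j <;> simp [D, diagonal_conjTranspose]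
      · field_simp
        linear_combination -hsd2
      · field_simp
        linear_combination -hse2
    · ext i j
      fin_cases i <;> fin_cases j <;> simp [D, hsd, hse]

lemma exists_schmidt_decomposition {X : Matrix (Fin 2) (Fin 2) ℂ} (hX : (X * Xᴴ).trace = 1) :
    ∃ A ∈ unitaryGroup (Fin 2) ℂ, ∃ B ∈ unitaryGroup (Fin 2) ℂ, ∃ a : ℝ, 0 ≤ a ∧
      a ^ 2 ≤ 1 / 2 ∧ A * X * Bᵀ = schmidtMatrix a := by
  obtain ⟨U, hU, d, e, hde, hD⟩ :=
    exists_unitary_diagonalization (isHermitian_mul_conjTranspose_self X)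
  have hUU := mem_unitaryGroup_iff'.1 hU
  rw [star_eq_conjTranspose] at hUU
  have htr : d + e = 1 := by
    have := congrArg trace hD
    rw [trace_mul_comm, ← Matrix.mul_assoc, hUU, Matrix.one_mul, hX] at this
    simp at this
    exact_mod_cast this.symm
  have hY : (U * X) * (U * X)ᴴ = diagonal ![(d : ℂ), (e : ℂ)] := by
    rw [← hD, conjTranspose_mul]
    simp only [Matrix.mul_assoc]
  obtain ⟨V, hV, hUX⟩ := exists_unitary_of_rows_orthogonal (by linarith) hY
  have hd : 0 ≤ d := by
    have h00 := congrFun (congrFun hY 0) 0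
    simp only [mul_apply, Fin.sum_univ_two, conjTranspose_apply, Complex.star_def,
      Complex.mul_conj', diagonal_apply_eq, cons_val_zero] at h00
    norm_cast at h00
    rw [← h00]
    positivity
  refine ⟨U, hU, (star V)ᵀ, ?_, Real.sqrt d, Real.sqrt_nonneg d, ?_, ?_⟩
  · have hconj : star (star V)ᵀ = Vᵀ := by
      ext i j
      simp [star_apply]
    rw [mem_unitaryGroup_iff, hconj, ← transpose_mul, mem_unitaryGroup_iff.1 hV, transpose_one]
  · rw [Real.sq_sqrt hd]; linarith
  · rw [transpose_transpose, hUX, Matrix.mul_assoc, mem_unitaryGroup_iff.1 hV, Matrix.mul_one,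
      schmidtMatrix, Real.sq_sqrt hd, ← htr, add_sub_cancel_left]

lemma mul_one_add_smul_vecMulVec {n : Type*} [Fintype n] [DecidableEq n] {K : Matrix n n ℂ}
    (hK : K ∈ unitaryGroup n ℂ) (c : ℂ) (x : n → ℂ) :
    K * (1 + c • vecMulVec x (star x)) =
      (1 + c • vecMulVec (K *ᵥ x) (star (K *ᵥ x))) * K := by
  have h := mem_unitaryGroup_iff'.1 hK
  rw [star_eq_conjTranspose] at h
  rw [Matrix.mul_add, Matrix.add_mul, Matrix.mul_smul, Matrix.smul_mul, mul_vecMulVec,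
    vecMulVec_mul, star_mulVec, vecMul_vecMul, h, vecMul_one, Matrix.mul_one, Matrix.one_mul]

lemma det_mul_star_det_eq_of_vecMulVec_eq {X Y : Matrix (Fin 2) (Fin 2) ℂ}
    (h : vecMulVec (vecOfMatrix X) (star (vecOfMatrix X)) =
      vecMulVec (vecOfMatrix Y) (star (vecOfMatrix Y))) :
    X.det * star X.det = Y.det * star Y.det := by
  have hE (i j k m : Fin 2) : X i j * star (X k m) = Y i j * star (Y k m) := by
    simpa [vecMulVec_apply, vecOfMatrix] using congrFun (congrFun h (i, j)) (k, m)
  have expand (Z : Matrix (Fin 2) (Fin 2) ℂ) : Z.det * star Z.det =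
      (Z 0 0 * star (Z 0 0)) * (Z 1 1 * star (Z 1 1))
      - (Z 0 0 * star (Z 0 1)) * (Z 1 1 * star (Z 1 0))
      - (Z 0 1 * star (Z 0 0)) * (Z 1 0 * star (Z 1 1))
      + (Z 0 1 * star (Z 0 1)) * (Z 1 0 * star (Z 1 0)) := by
    rw [det_fin_two]
    simp only [star_sub, star_mul]
    ring
  simp only [expand, hE]

lemma det_mul_star_det_of_mem_unitary {A : Matrix (Fin 2) (Fin 2) ℂ}
    (hA : A ∈ unitaryGroup (Fin 2) ℂ) : A.det * star A.det = 1 := by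
  have := congrArg det (mem_unitaryGroup_iff.1 hA)
  rwa [det_mul, star_eq_conjTranspose, det_conjTranspose, det_one] at this

lemma trace_uMat (a : ℝ) (l : ℂ) : (uMat a l).trace = 3 + l := by
  simp [trace, uMat, Fintype.sum_prod_type]
  ring

lemma det_mul_star_det_schmidtMatrix {a : ℝ} (ha : a ^ 2 ≤ 1 / 2) :
    (schmidtMatrix a).det * star (schmidtMatrix a).det = ((a ^ 2 * (1 - a ^ 2) : ℝ) : ℂ) := by
  rw [schmidtMatrix, det_diagonal]
  simp only [Fin.prod_univ_two, cons_val_zero, cons_val_one, star_mul, Complex.star_def,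
    Complex.conj_ofReal]
  rw [← Real.sq_sqrt (show 0 ≤ 1 - a ^ 2 by linarith)]
  push_cast
  rw [Real.sq_sqrt (show 0 ≤ 1 - a ^ 2 by linarith)]
  ring

lemma exists_prodUnitaryEquiv_uMat {u : Matrix (Fin 2 × Fin 2) (Fin 2 × Fin 2) ℂ}
    (hu : u ∈ unitaryGroup (Fin 2 × Fin 2) ℂ)
    (hk : Module.finrank ℂ (LinearMap.ker (mulVecLin (u - 1))) = 3) :
    ∃ (a : ℝ) (l : ℂ), 0 ≤ a ∧ a ≤ 1 / Real.sqrt 2 ∧ ‖l‖ = 1 ∧ l ≠ 1 ∧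
      ProdUnitaryEquiv u (uMat a l) := by
  obtain ⟨l, X, hl, hl1, hX, rfl⟩ := exists_eq_one_add_smul_of_finrank_ker hu hk
  obtain ⟨A, hA, B, hB, a, ha0, ha, hAB⟩ := exists_schmidt_decomposition hX
  refine ⟨a, l, ha0, ?_, hl, hl1, A, B, hA, hB, ?_⟩
  · rw [← Real.sqrt_one, ← Real.sqrt_div (by norm_num)]
    exact Real.le_sqrt_of_sq_le ha
  · rw [uMat_eq ha, ← hAB, ← kronecker_mulVec_vecOfMatrix]
    exact mul_one_add_smul_vecMulVec (kronecker_mem_unitary hA hB) _ _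

lemma eq_and_eq_of_prodUnitaryEquiv_uMat {a b : ℝ} {l μ : ℂ} (ha0 : 0 ≤ a) (ha : a ^ 2 ≤ 1 / 2)
    (hb0 : 0 ≤ b) (hb : b ^ 2 ≤ 1 / 2) (hl : l ≠ 1)
    (h : ProdUnitaryEquiv (uMat a l) (uMat b μ)) : a = b ∧ l = μ := by
  obtain ⟨A, B, hA, hB, hAB⟩ := h
  change (A ⊗ₖ B) * _ = _ * (A ⊗ₖ B) at hAB
  have hK : A ⊗ₖ B ∈ unitaryGroup (Fin 2 × Fin 2) ℂ := kronecker_mem_unitary hA hB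
  have hKK := mem_unitaryGroup_iff.1 hK
  have hlμ : l = μ := by
    have := congrArg (fun M => (M * star (A ⊗ₖ B)).trace) hAB
    simp only [Matrix.mul_assoc _ (A ⊗ₖ B) (star (A ⊗ₖ B)), hKK, Matrix.mul_one] at this
    rw [trace_mul_comm, ← Matrix.mul_assoc, mem_unitaryGroup_iff'.1 hK, Matrix.one_mul,
      trace_uMat, trace_uMat] at this
    exact add_left_cancel this
  subst hlμ
  refine ⟨?_, rfl⟩
  rw [uMat_eq ha, uMat_eq hb, mul_one_add_smul_vecMulVec hK] at hAB
  have hcancel := congrArg (· * star (A ⊗ₖ B)) hAB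
  simp only [Matrix.mul_assoc, hKK, Matrix.mul_one] at hcancel
  have hproj := smul_right_injective _ (sub_ne_zero.2 hl) (add_left_cancel hcancel)
  rw [kronecker_mulVec_vecOfMatrix] at hproj
  have hdet := det_mul_star_det_eq_of_vecMulVec_eq hproj
  have hfac : (A * schmidtMatrix a * Bᵀ).det * star (A * schmidtMatrix a * Bᵀ).det =
      (A.det * star A.det) * (B.det * star B.det) *
        ((schmidtMatrix a).det * star (schmidtMatrix a).det) := by
    rw [det_mul, det_mul, det_transpose, star_mul, star_mul]
    ring
  rw [hfac, det_mul_star_det_of_mem_unitary hA, det_mul_star_det_of_mem_unitary hB,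
    det_mul_star_det_schmidtMatrix ha, det_mul_star_det_schmidtMatrix hb, one_mul, one_mul,
    Complex.ofReal_inj] at hdet
  have hsq : a ^ 2 = b ^ 2 := by nlinarith
  exact (sq_eq_sq₀ ha0 hb0).1 hsq

end

/-- every 4×4 unitary with `dim Ker(u−I) = 3` is product unitary
equivalent to `u(a,λ)` for exactly one pair `(a,λ)` with `0 ≤ a ≤ 1/√2`, `|λ| = 1`,
`λ ≠ 1`. -/
theorem stmt_11 :
    (∀ u : Matrix (Fin 2 × Fin 2) (Fin 2 × Fin 2) ℂ,
      u ∈ Matrix.unitaryGroup (Fin 2 × Fin 2) ℂ →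
      Module.finrank ℂ (LinearMap.ker (Matrix.mulVecLin (u - 1))) = 3 →
      ∃ (a : ℝ) (l : ℂ), 0 ≤ a ∧ a ≤ 1 / Real.sqrt 2 ∧ ‖l‖ = 1 ∧ l ≠ 1 ∧
        ProdUnitaryEquiv u (uMat a l)) ∧
    (∀ (a b : ℝ) (l μ : ℂ),
      0 ≤ a → a ≤ 1 / Real.sqrt 2 → 0 ≤ b → b ≤ 1 / Real.sqrt 2 →
      ‖l‖ = 1 → l ≠ 1 → ‖μ‖ = 1 → μ ≠ 1 →
      ProdUnitaryEquiv (uMat a l) (uMat b μ) → a = b ∧ l = μ) := by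
  exact ⟨fun _ hu hk => exists_prodUnitaryEquiv_uMat hu hk,
    fun _ _ _ _ ha0 ha hb0 hb _ hl _ _ h => eq_and_eq_of_prodUnitaryEquiv_uMat ha0
      (sq_le_half_of_le ha0 ha) hb0 (sq_le_half_of_le hb0 hb) hl h⟩
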